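/- Let b = e^{iπ/8} or b = e^{−iπ/8}, with arg(b) = ±π/8 and arg(b²) = ±π/4 accordingly. Let μ ∈ ℂ be such that μ is not an odd integer, let m ∈ {0, 1}, and set C_{μ,1} = Γ(1/2)/Γ(−(μ+1)/4) and C_{μ,2} = Γ(3/2)/Γ((1−μ)/4) (Γ the complex Gamma function). Then, with complex powers in the principal branch, as z → +∞ and as z → −∞ in ℝ: ψ_{μ,1}(b·z) is asymptotically equivalent to C_{μ,1}·exp(b²·z²/2)·(b²·z²)^{−(μ+3)/4}; ∫_0^z (b²·z̃²)^m·ψ_{μ,1}(b·z̃) dz̃ is asymptotically equivalent to (C_{μ,1}/b)·exp(b²·z²/2)·(b²·z²)^{m−(μ+3)/4}/(b·z); ψ_{μ,2}(b·z) is asymptotically equivalent to C_{μ,2}·exp(b²·z²/2)·(b²·z²)^{−(μ+5)/4}·(b·z); and ∫_0^z (b²·z̃²)^m·ψ_{μ,2}(b·z̃) dz̃ is asymptotically equivalent to (C_{μ,2}/b)·exp(b²·z²/2)·(b²·z²)^{m−(μ+5)/4}. -/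

import Mathlib

open Complex Filter Asymptotics

/-- Rising Pochhammer symbol in `ℂ`. -/
noncomputable def pochC (x : ℂ) (n : ℕ) : ℂ := ∏ i ∈ Finset.range n, (x + (i : ℂ))

/-- Kummer's confluent hypergeometric function of the first kind. -/
noncomputable def kummerM (a c ζ : ℂ) : ℂ :=
  ∑' n : ℕ, pochC a n / pochC c n * ζ ^ n / (n.factorial : ℂ)

/-- `ψ_{μ,1}`. -/
noncomputable def psi1 (μ η : ℂ) : ℂ :=
  kummerM (-(1 + μ) / 4) (1 / 2) (η ^ 2) * Complex.exp (-η ^ 2 / 2)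

/-- `ψ_{μ,2}`. -/
noncomputable def psi2 (μ η : ℂ) : ℂ :=
  η * kummerM ((1 - μ) / 4) (3 / 2) (η ^ 2) * Complex.exp (-η ^ 2 / 2)

open scoped Topology

/-- If `F'` is negligible with respect to `h' ≥ 0` and `h → ∞`, then `F` is negligible with respect
to `h`. -/
theorem isLittleO_of_hasDerivAt_isLittleO {F F' : ℝ → ℂ} {h h' : ℝ → ℝ}
    (hF : ∀ᶠ x in atTop, HasDerivAt F (F' x) x) (hh : ∀ᶠ x in atTop, HasDerivAt h (h' x) x)
    (hpos : ∀ᶠ x in atTop, 0 ≤ h' x) (ho : F' =o[atTop] h') (htop : Tendsto h atTop atTop) :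
    F =o[atTop] h := by
  rw [isLittleO_iff] at ho ⊢
  intro c hc
  obtain ⟨S, hS⟩ := eventually_atTop.1 (hF.and (hh.and (hpos.and (ho (half_pos hc)))))
  have key : ∀ z ≥ S, ‖F z‖ ≤ ‖F S‖ + c / 2 * (h z - h S) := by
    intro z hz
    have hd : ∀ x ∈ Set.Icc S z, HasDerivAt (fun y => ‖F S‖ + c / 2 * (h y - h S))
        (c / 2 * h' x) x := fun x hx =>
      (((hS x hx.1).2.1.sub_const (h S)).const_mul (c / 2)).const_add _
    refine image_norm_le_of_norm_deriv_right_le_deriv_boundary' (f := F) (f' := F') (a := S) (b := z)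
      (B := fun y => ‖F S‖ + c / 2 * (h y - h S)) (B' := fun x => c / 2 * h' x)
      (fun x hx => (hS x hx.1).1.continuousAt.continuousWithinAt)
      (fun x hx => (hS x hx.1).1.hasDerivWithinAt) (by simp)
      (fun x hx => (hd x hx).continuousAt.continuousWithinAt)
      (fun x hx => (hd x ⟨hx.1, hx.2.le⟩).hasDerivWithinAt) (fun x hx => ?_) ⟨hz, le_rfl⟩
    have h2 := (hS x hx.1).2.2.2
    rwa [Real.norm_of_nonneg (hS x hx.1).2.2.1] at h2
  filter_upwards [eventually_ge_atTop S, htop.eventually_ge_atTop 0,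
    htop.eventually_ge_atTop ((‖F S‖ - c / 2 * h S) / (c / 2))] with z hz h0 h1
  rw [Real.norm_of_nonneg h0]
  rw [div_le_iff₀ (half_pos hc)] at h1
  have := key z hz
  linarith

/-- The comparison function `exp (β z²) z ^ γ`. -/
noncomputable def gaussPow (β γ : ℂ) (z : ℝ) : ℂ := Complex.exp (β * (z : ℂ) ^ 2) * (z : ℂ) ^ γ

theorem gaussPow_ne_zero (β γ : ℂ) {z : ℝ} (hz : 0 < z) : gaussPow β γ z ≠ 0 := by
  have : (z : ℂ) ≠ 0 := by exact_mod_cast hz.ne'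
  exact mul_ne_zero (Complex.exp_ne_zero _) (by simp [Complex.cpow_eq_zero_iff, this])

theorem norm_gaussPow (β γ : ℂ) {z : ℝ} (hz : 0 < z) :
    ‖gaussPow β γ z‖ = Real.exp (β.re * z ^ 2) * z ^ γ.re := by
  rw [gaussPow, norm_mul, Complex.norm_exp, Complex.norm_cpow_eq_rpow_re_of_pos hz]
  congr 2
  rw [← Complex.ofReal_pow, Complex.re_mul_ofReal]

theorem gaussPow_mul_cpow (β γ δ : ℂ) {z : ℝ} (hz : 0 < z) :
    gaussPow β γ z * (z : ℂ) ^ δ = gaussPow β (γ + δ) z := by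
  have : (z : ℂ) ≠ 0 := by exact_mod_cast hz.ne'
  rw [gaussPow, gaussPow, Complex.cpow_add _ _ this, mul_assoc]

theorem hasDerivAt_ofReal_cpow {z : ℝ} (hz : 0 < z) (γ : ℂ) :
    HasDerivAt (fun x : ℝ => (x : ℂ) ^ γ) (γ * (z : ℂ) ^ (γ - 1)) z := by
  have := ((hasDerivAt_id (z : ℂ)).cpow_const (c := γ) (Or.inl (by simpa using hz))).comp_ofReal
  simpa using this

theorem hasDerivAt_gaussPow (β γ : ℂ) {z : ℝ} (hz : 0 < z) :
    HasDerivAt (gaussPow β γ) (2 * β * gaussPow β (γ + 1) z + γ * gaussPow β (γ - 1) z) z := by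
  have h0 : (z : ℂ) ≠ 0 := by exact_mod_cast hz.ne'
  have h1 : HasDerivAt (fun x : ℝ => Complex.exp (β * (x : ℂ) ^ 2))
      (Complex.exp (β * (z : ℂ) ^ 2) * (β * (2 * z))) z := by
    have := (((hasDerivAt_id (z : ℂ)).pow 2).const_mul β).cexp.comp_ofReal
    simpa using this
  refine (h1.mul (hasDerivAt_ofReal_cpow hz γ)).congr_deriv ?_
  simp only [gaussPow]
  rw [Complex.cpow_add _ _ h0, Complex.cpow_one]
  ring

theorem gaussPow_isLittleO (β : ℂ) {γ δ : ℂ} (h : δ.re < γ.re) :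
    gaussPow β δ =o[atTop] gaussPow β γ := by
  rw [isLittleO_iff_tendsto' ((eventually_gt_atTop 0).mono
    fun z hz h0 => absurd h0 (gaussPow_ne_zero β γ hz))]
  rw [tendsto_zero_iff_norm_tendsto_zero]
  refine (tendsto_rpow_neg_atTop (sub_pos.2 h)).congr' ?_
  filter_upwards [eventually_gt_atTop 0] with z hz
  rw [norm_div, norm_gaussPow _ _ hz, norm_gaussPow _ _ hz, mul_div_mul_left _ _ (Real.exp_pos _).ne',
    ← Real.rpow_sub hz]
  congr 1
  ring

theorem tendsto_exp_mul_sq_mul_rpow_atTop {ρ : ℝ} (hρ : 0 < ρ) (s : ℝ) :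
    Tendsto (fun z : ℝ => Real.exp (ρ * z ^ 2) * z ^ s) atTop atTop := by
  refine tendsto_atTop_mono' _ ?_ (tendsto_exp_mul_div_rpow_atTop (-s) ρ hρ)
  filter_upwards [eventually_ge_atTop 1] with z hz
  have hz0 : 0 < z := by linarith
  rw [Real.rpow_neg hz0.le, div_inv_eq_mul]
  gcongr
  nlinarith

/-- `f` behaves like `C exp (β z²) z ^ γ` at `+∞`. -/
def HasGaussAsymp (β γ C : ℂ) (f : ℝ → ℂ) : Prop :=
  Tendsto (fun z => f z / gaussPow β γ z) atTop (𝓝 C)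

theorem hasGaussAsymp_iff {β γ C : ℂ} {f : ℝ → ℂ} :
    HasGaussAsymp β γ C f ↔ (fun z => f z - C * gaussPow β γ z) =o[atTop] gaussPow β γ := by
  rw [isLittleO_iff_tendsto' ((eventually_gt_atTop 0).mono
    fun z hz h0 => absurd h0 (gaussPow_ne_zero β γ hz)), HasGaussAsymp, ← tendsto_sub_nhds_zero_iff]
  refine tendsto_congr' ?_
  filter_upwards [eventually_gt_atTop 0] with z hz
  rw [sub_div, mul_div_cancel_right₀ _ (gaussPow_ne_zero β γ hz)]

theorem HasGaussAsymp.of_hasDerivAt {β γ C : ℂ} {F f : ℝ → ℂ} (hβ : 0 < β.re)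
    (hF : ∀ z > 0, HasDerivAt F (f z) z) (hf : HasGaussAsymp β γ C f) :
    HasGaussAsymp β (γ - 1) (C / (2 * β)) F := by
  have hβ0 : β ≠ 0 := fun h => by simp [h] at hβ
  rw [hasGaussAsymp_iff] at hf ⊢
  set h : ℝ → ℝ := fun z => Real.exp (β.re * z ^ 2) * z ^ (γ.re - 1) with hh
  set h' : ℝ → ℝ := fun z => Real.exp (β.re * z ^ 2) * (2 * β.re * z ^ γ.re +
    (γ.re - 1) * z ^ (γ.re - 2)) with hh'
  have hderiv : ∀ z > 0, HasDerivAt h (h' z) z := by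
    intro z hz
    have h1 : HasDerivAt (fun x : ℝ => Real.exp (β.re * x ^ 2))
        (Real.exp (β.re * z ^ 2) * (β.re * (2 * z))) z := by
      simpa using (((hasDerivAt_id z).pow 2).const_mul β.re).exp
    refine (h1.mul (Real.hasDerivAt_rpow_const (p := γ.re - 1) (Or.inl hz.ne'))).congr_deriv ?_
    have : z ^ γ.re = z * z ^ (γ.re - 1) := by
      rw [Real.rpow_sub_one hz.ne']
      field_simp
    simp only [hh', this]
    ring_nf
  have hlow : ∀ᶠ z in atTop, β.re * ‖gaussPow β γ z‖ ≤ h' z := by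
    filter_upwards [eventually_gt_atTop 0, eventually_ge_atTop (|γ.re - 1| / β.re),
      eventually_ge_atTop 1] with z hz hz1 hz2
    rw [norm_gaussPow _ _ hz, hh']
    have e : z ^ γ.re = z ^ 2 * z ^ (γ.re - 2) := by
      rw [← Real.rpow_natCast z 2, ← Real.rpow_add hz]
      congr 1
      push_cast
      ring
    have h3 : 0 ≤ β.re * z ^ 2 + (γ.re - 1) := by
      rw [div_le_iff₀ hβ] at hz1
      have := neg_abs_le (γ.re - 1)
      have : β.re * z ≤ β.re * z ^ 2 := by
        gcongr
        nlinarith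
      linarith
    simp only [e]
    have := mul_nonneg (mul_nonneg (Real.exp_pos (β.re * z ^ 2)).le h3)
      (Real.rpow_nonneg hz.le (γ.re - 2))
    linarith
  have hO : gaussPow β γ =O[atTop] h' := by
    refine IsBigO.of_bound (β.re)⁻¹ ?_
    filter_upwards [hlow] with z hz
    rw [inv_mul_eq_div, le_div_iff₀ hβ, mul_comm]
    exact hz.trans (le_abs_self _)
  have hres := isLittleO_of_hasDerivAt_isLittleO
    (F := fun z => F z - C / (2 * β) * gaussPow β (γ - 1) z)
    (F' := fun z => (f z - C * gaussPow β γ z) -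
      C / (2 * β) * ((γ - 1) * gaussPow β (γ - 2) z)) (h := h) (h' := h') ?_
    ((eventually_gt_atTop 0).mono hderiv)
    (hlow.mono fun z hz => (mul_nonneg hβ.le (norm_nonneg _)).trans hz) ?_
    (tendsto_exp_mul_sq_mul_rpow_atTop hβ _)
  · refine hres.trans_isBigO (IsBigO.of_bound 1 ?_)
    filter_upwards [eventually_gt_atTop 0] with z hz
    rw [norm_gaussPow _ _ hz, hh, one_mul, Real.norm_of_nonneg (by positivity)]
    simp
  · filter_upwards [eventually_gt_atTop 0] with z hz
    refine ((hF z hz).sub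
      ((hasDerivAt_gaussPow β (γ - 1) hz).const_mul (C / (2 * β)))).congr_deriv ?_
    rw [sub_add_cancel, show γ - 1 - 1 = γ - 2 by ring]
    field_simp
    ring
  · refine IsLittleO.trans_isBigO (IsLittleO.sub hf ?_) hO
    exact ((gaussPow_isLittleO β (by simp)).const_mul_left _).const_mul_left _

theorem HasGaussAsymp.congr_mul {β γ C β' γ' c : ℂ} {f g : ℝ → ℂ} (hf : HasGaussAsymp β γ C f)
    (h : ∀ z : ℝ, 0 < z → g z / gaussPow β' γ' z = c * (f z / gaussPow β γ z)) :
    HasGaussAsymp β' γ' (c * C) g :=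
  (hf.const_mul c).congr' ((eventually_gt_atTop 0).mono fun z hz => (h z hz).symm)

theorem HasGaussAsymp.isEquivalent {β γ C : ℂ} {f g : ℝ → ℂ} (hf : HasGaussAsymp β γ C f)
    (hC : C ≠ 0) (hg : ∀ z : ℝ, 0 < z → g z = C * gaussPow β γ z) : IsEquivalent atTop f g := by
  have h1 : (fun z => f z - C * gaussPow β γ z) =o[atTop] fun z => C * gaussPow β γ z :=
    (isLittleO_const_mul_right_iff hC).2 (hasGaussAsymp_iff.1 hf)
  have h2 : IsEquivalent atTop f (fun z => C * gaussPow β γ z) := h1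
  exact h2.congr_right ((eventually_gt_atTop 0).mono fun z hz => (hg z hz).symm)

theorem isEquivalent_atBot_of_parity {f g : ℝ → ℂ} (σ : ℂ) (hσ : σ ≠ 0)
    (hf : ∀ z, f (-z) = σ * f z) (hg : ∀ z, g (-z) = σ * g z) (h : IsEquivalent atTop f g) :
    IsEquivalent atBot f g := by
  have h1 := h.comp_tendsto tendsto_neg_atBot_atTop
  have h2 : (fun z => f (-z) - g (-z)) =o[atBot] fun z => g (-z) := h1
  simp only [hf, hg, ← mul_sub] at h2
  exact (isLittleO_const_mul_right_iff hσ).1 ((isLittleO_const_mul_left_iff hσ).1 h2)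

theorem pochC_succ (x : ℂ) (n : ℕ) : pochC x (n + 1) = pochC x n * (x + n) :=
  Finset.prod_range_succ _ _

theorem pochC_mul_add (x : ℂ) (n : ℕ) : pochC x n * (x + n) = x * pochC (x + 1) n := by
  rw [← pochC_succ, pochC, Finset.prod_range_succ', pochC, mul_comm]
  simp only [Nat.cast_zero, add_zero, Nat.cast_add, Nat.cast_one]
  congr 1
  exact Finset.prod_congr rfl fun i _ => by ring

theorem norm_pochC_div_le (a : ℂ) {c : ℂ} (hc : 1 / 2 ≤ c.re) (n : ℕ) :
    ‖pochC a n / pochC c n‖ ≤ (2 * ‖a‖ + 1) ^ n := by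
  rw [pochC, pochC, ← Finset.prod_div_distrib, norm_prod]
  refine (Finset.prod_le_prod (g := fun _ => 2 * ‖a‖ + 1) (fun _ _ => norm_nonneg _)
    fun i _ => ?_).trans_eq (by simp)
  have h1 : (1 / 2 + i : ℝ) ≤ ‖c + i‖ := by
    refine le_trans ?_ ((le_abs_self _).trans (Complex.abs_re_le_norm _))
    simpa using hc
  have hi : (0 : ℝ) ≤ i := i.cast_nonneg
  have h2 : ‖a + i‖ ≤ ‖a‖ + i := (norm_add_le _ _).trans_eq (by simp)
  rw [norm_div, div_le_iff₀ (by linarith)]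
  nlinarith [norm_nonneg a]

theorem norm_kummerM_term_le (a : ℂ) {c : ℂ} (hc : 1 / 2 ≤ c.re) (ζ : ℂ) (n : ℕ) :
    ‖pochC a n / pochC c n * ζ ^ n / (n.factorial : ℂ)‖ ≤
      ((2 * ‖a‖ + 1) * ‖ζ‖) ^ n / n.factorial := by
  rw [norm_div, norm_mul, norm_pow, Complex.norm_natCast, mul_pow]
  gcongr
  exact norm_pochC_div_le a hc n

theorem hasSum_kummerM (a : ℂ) {c : ℂ} (hc : 1 / 2 ≤ c.re) (ζ : ℂ) :
    HasSum (fun n : ℕ => pochC a n / pochC c n * ζ ^ n / (n.factorial : ℂ)) (kummerM a c ζ) :=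
  (Summable.of_norm_bounded (Real.summable_pow_div_factorial _)
    (norm_kummerM_term_le a hc ζ)).hasSum

theorem norm_kummerM_term_le_of_mem_ball (a : ℂ) {c : ℂ} (hc : 1 / 2 ≤ c.re) (R : ℝ) (n : ℕ) (w : ℂ)
    (hw : w ∈ Metric.ball (0 : ℂ) R) : ‖pochC a n / pochC c n * w ^ n / (n.factorial : ℂ)‖ ≤
      ((2 * ‖a‖ + 1) * R) ^ n / n.factorial := by
  refine (norm_kummerM_term_le a hc w n).trans ?_
  have : ‖w‖ ≤ R := (mem_ball_zero_iff.1 hw).le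
  gcongr

theorem differentiable_kummerM (a : ℂ) {c : ℂ} (hc : 1 / 2 ≤ c.re) :
    Differentiable ℂ (kummerM a c) := fun ζ =>
  (Complex.differentiableOn_tsum_of_summable_norm (U := Metric.ball 0 (‖ζ‖ + 1))
    (Real.summable_pow_div_factorial _) (fun n => by fun_prop) Metric.isOpen_ball
    (norm_kummerM_term_le_of_mem_ball a hc _)).differentiableAt
    (Metric.isOpen_ball.mem_nhds (by simp))

theorem hasSum_mul_deriv_kummerM (a : ℂ) {c : ℂ} (hc : 1 / 2 ≤ c.re) (ζ : ℂ) :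
    HasSum (fun n : ℕ => n * (pochC a n / pochC c n * ζ ^ n / (n.factorial : ℂ)))
      (ζ * deriv (kummerM a c) ζ) := by
  have := (Complex.hasSum_deriv_of_summable_norm (U := Metric.ball 0 (‖ζ‖ + 1)) (z := ζ)
    (Real.summable_pow_div_factorial _) (fun n => by fun_prop) Metric.isOpen_ball
    (norm_kummerM_term_le_of_mem_ball a hc _) (by simp)).mul_left ζ
  convert! this using 2 with n
  have h := (((hasDerivAt_id ζ).pow n).const_mul (pochC a n / pochC c n)).div_const
    (n.factorial : ℂ)
  simp only [id_eq, mul_one] at h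
  rw [show deriv (fun w : ℂ => pochC a n / pochC c n * w ^ n / (n.factorial : ℂ)) ζ = _ from h.deriv]
  rcases n with _ | n
  · simp
  · rw [Nat.add_sub_cancel]
    ring

/-- The parameter-raising relation `(a + ζ d/dζ) M(a, c, ζ) = a M(a + 1, c, ζ)`. -/
theorem kummerM_raise (a : ℂ) {c : ℂ} (hc : 1 / 2 ≤ c.re) (ζ : ℂ) :
    a * kummerM a c ζ + ζ * deriv (kummerM a c) ζ = a * kummerM (a + 1) c ζ := by
  refine HasSum.unique (((hasSum_kummerM a hc ζ).mul_left a).add (hasSum_mul_deriv_kummerM a hc ζ)) ?_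
  convert! (hasSum_kummerM (a + 1) hc ζ).mul_left a using 2 with n
  linear_combination (ζ ^ n / (pochC c n * n.factorial)) * pochC_mul_add a n

/-- The parameter-lowering relation `(c + ζ d/dζ) M(a, c + 1, ζ) = c M(a, c, ζ)`. -/
theorem kummerM_lower (a : ℂ) {c : ℂ} (hc : 1 / 2 ≤ c.re) (ζ : ℂ) :
    c * kummerM a (c + 1) ζ + ζ * deriv (kummerM a (c + 1)) ζ = c * kummerM a c ζ := by
  have hc' : 1 / 2 ≤ (c + 1).re := by rw [Complex.add_re, Complex.one_re]; linarith
  refine HasSum.unique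
    (((hasSum_kummerM a hc' ζ).mul_left c).add (hasSum_mul_deriv_kummerM a hc' ζ)) ?_
  convert! (hasSum_kummerM a hc ζ).mul_left c using 2 with n
  have h1 (m : ℕ) : c + m ≠ 0 := fun h => by
    have := congrArg Complex.re h
    simp at this
    linarith [(m.cast_nonneg : (0 : ℝ) ≤ m)]
  have h2 : pochC c n ≠ 0 := Finset.prod_ne_zero_iff.2 fun i _ => h1 i
  have h0 : c ≠ 0 := by simpa using h1 0
  have h3 : pochC (c + 1) n ≠ 0 := fun h => by
    have := pochC_mul_add c n
    rw [h, mul_zero] at this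
    exact mul_ne_zero h2 (h1 n) this
  have h4 := pochC_mul_add c n
  have h5 : (n.factorial : ℂ) ≠ 0 := by exact_mod_cast n.factorial_ne_zero
  field_simp
  linear_combination (pochC a n * ζ ^ n) * h4

theorem hasDerivAt_kummerM_quadratic (a : ℂ) {c : ℂ} (hc : 1 / 2 ≤ c.re) (r : ℂ) (z : ℝ) :
    HasDerivAt (fun x : ℝ => kummerM a c (r * (x : ℂ) ^ 2))
      (2 * r * z * deriv (kummerM a c) (r * (z : ℂ) ^ 2)) z := by
  have h1 : HasDerivAt (fun w : ℂ => r * w ^ 2) (r * (2 * z)) (z : ℂ) := by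
    simpa using ((hasDerivAt_id (z : ℂ)).pow 2).const_mul r
  refine ((differentiable_kummerM a hc _).hasDerivAt.comp (z : ℂ) h1).comp_ofReal.congr_deriv ?_
  ring

theorem hasDerivAt_cpow_mul_kummerM (a : ℂ) {c : ℂ} (hc : 1 / 2 ≤ c.re) (r : ℂ) {z : ℝ}
    (hz : 0 < z) :
    HasDerivAt (fun x : ℝ => (x : ℂ) ^ (2 * a) * kummerM a c (r * (x : ℂ) ^ 2))
      (2 * a * (z : ℂ) ^ (2 * a - 1) * kummerM (a + 1) c (r * (z : ℂ) ^ 2)) z := by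
  refine ((hasDerivAt_ofReal_cpow hz (2 * a)).mul
    (hasDerivAt_kummerM_quadratic a hc r z)).congr_deriv ?_
  have h0 : (z : ℂ) ≠ 0 := by exact_mod_cast hz.ne'
  have h1 := kummerM_raise a hc (r * (z : ℂ) ^ 2)
  have h2 : (z : ℂ) ^ (2 * a) = z ^ (2 * a - 1) * z := by
    rw [Complex.cpow_sub _ _ h0, Complex.cpow_one]
    field_simp
  rw [h2]
  linear_combination (2 * (z : ℂ) ^ (2 * a - 1)) * h1

theorem hasDerivAt_mul_kummerM_three_half (a r : ℂ) (z : ℝ) :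
    HasDerivAt (fun x : ℝ => (x : ℂ) * kummerM a (3 / 2) (r * (x : ℂ) ^ 2))
      (kummerM a (1 / 2) (r * (z : ℂ) ^ 2)) z := by
  have h1 : HasDerivAt (fun x : ℝ => (x : ℂ)) 1 z := (hasDerivAt_id (z : ℂ)).comp_ofReal
  refine (h1.mul (hasDerivAt_kummerM_quadratic a (c := 3 / 2) (by norm_num) r z)).congr_deriv ?_
  have h2 := kummerM_lower a (c := 1 / 2) (by norm_num) (r * (z : ℂ) ^ 2)
  rw [show (1 / 2 + 1 : ℂ) = 3 / 2 by norm_num] at h2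
  linear_combination 2 * h2

open MeasureTheory in
theorem integrableOn_rpow_mul_exp_quadratic {ρ s : ℝ} (hρ : 0 < ρ) (hs : -1 < s) (k : ℝ) :
    IntegrableOn (fun x : ℝ => x ^ s * Real.exp (-ρ * x ^ 2 + k * x)) (Set.Ioi 0) := by
  have h := ((integrable_rpow_mul_exp_neg_mul_sq (half_pos hρ) hs).const_mul
    (Real.exp (k ^ 2 / (2 * ρ)))).integrableOn (s := Set.Ioi 0)
  refine Integrable.mono' h (by fun_prop) ?_
  filter_upwards [ae_restrict_mem measurableSet_Ioi] with x hx
  have hx : 0 < x := hx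
  rw [Real.norm_of_nonneg (by positivity), mul_left_comm, ← Real.exp_add]
  refine mul_le_mul_of_nonneg_left (Real.exp_le_exp.2 ?_) (by positivity)
  have : 0 ≤ (ρ * x - k) ^ 2 / (2 * ρ) := by positivity
  have e : (ρ * x - k) ^ 2 / (2 * ρ) = k ^ 2 / (2 * ρ) + ρ / 2 * x ^ 2 - k * x := by
    field_simp
    ring
  linarith

open MeasureTheory in
theorem differentiableOn_gaussian_moment {a : ℂ} (ha : 0 < a.re) :
    DifferentiableOn ℂ (fun r : ℂ => ∫ s in Set.Ioi (0 : ℝ),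
      (s : ℂ) ^ (2 * a - 1) * Complex.exp (-r * (s : ℂ) ^ 2)) {r | 0 < r.re} := by
  intro r hr
  have hr : 0 < r.re := hr
  have hball : ∀ x ∈ Metric.ball r (r.re / 2), r.re / 2 ≤ x.re := by
    intro x hx
    have h1 := (Complex.abs_re_le_norm (x - r)).trans (mem_ball_iff_norm.1 hx).le
    rw [Complex.sub_re] at h1
    linarith [(abs_le.1 h1).1]
  have hnorm : ∀ (x : ℂ) (s : ℝ), 0 < s → ‖(s : ℂ) ^ (2 * a - 1) * Complex.exp (-x * (s : ℂ) ^ 2)‖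
      = s ^ (2 * a.re - 1) * Real.exp (-x.re * s ^ 2) := by
    intro x s hs
    rw [norm_mul, Complex.norm_cpow_eq_rpow_re_of_pos hs, Complex.norm_exp, ← Complex.ofReal_pow,
      Complex.re_mul_ofReal]
    simp
  have hmeas : ∀ (x : ℂ), AEStronglyMeasurable
      (fun s : ℝ => (s : ℂ) ^ (2 * a - 1) * Complex.exp (-x * (s : ℂ) ^ 2))
      (volume.restrict (Set.Ioi 0)) := fun x => by
    refine Measurable.aestronglyMeasurable ?_
    fun_prop
  have := (hasDerivAt_integral_of_dominated_loc_of_deriv_le (μ := volume.restrict (Set.Ioi 0))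
    (F := fun (r : ℂ) (s : ℝ) => (s : ℂ) ^ (2 * a - 1) * Complex.exp (-r * (s : ℂ) ^ 2))
    (F' := fun (r : ℂ) (s : ℝ) => (s : ℂ) ^ (2 * a - 1) *
      (Complex.exp (-r * (s : ℂ) ^ 2) * (-(s : ℂ) ^ 2)))
    (bound := fun s => s ^ (2 * a.re + 1) * Real.exp (-(r.re / 2) * s ^ 2 + 0 * s))
    (x₀ := r) (Metric.ball_mem_nhds r (half_pos hr)) (Eventually.of_forall hmeas) ?_ ?_ ?_
    (integrableOn_rpow_mul_exp_quadratic (half_pos hr) (by linarith) 0) ?_).2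
  · exact this.differentiableAt.differentiableWithinAt
  · refine (integrableOn_rpow_mul_exp_quadratic (s := 2 * a.re - 1) hr (by linarith) 0).mono'
      (hmeas r) ?_
    filter_upwards [ae_restrict_mem measurableSet_Ioi] with s hs
    rw [hnorm r s hs]
    simp
  · refine Measurable.aestronglyMeasurable ?_
    fun_prop
  · filter_upwards [ae_restrict_mem measurableSet_Ioi] with s hs x hx
    have hs : 0 < s := hs
    rw [← mul_assoc, norm_mul, hnorm x s hs, zero_mul, add_zero, norm_neg, norm_pow,
      Complex.norm_of_nonneg hs.le, mul_right_comm, ← Real.rpow_natCast, ← Real.rpow_add hs]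
    have := hball x hx
    rw [show 2 * a.re - 1 + ((2 : ℕ) : ℝ) = 2 * a.re + 1 by push_cast; ring]
    gcongr
  · filter_upwards with s x _
    have h1 : HasDerivAt (fun x : ℂ => -x * (s : ℂ) ^ 2) (-(s : ℂ) ^ 2) x := by
      simpa using (hasDerivAt_id x).neg.mul_const ((s : ℂ) ^ 2)
    exact h1.cexp.const_mul _

open MeasureTheory in
theorem gaussian_moment_of_real {a : ℂ} (ha : 0 < a.re) {r : ℝ} (hr : 0 < r) :
    ∫ s in Set.Ioi (0 : ℝ), (s : ℂ) ^ (2 * a - 1) * Complex.exp (-(r : ℂ) * (s : ℂ) ^ 2)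
      = (r : ℂ) ^ (-a) * Complex.Gamma a / 2 := by
  have h := Complex.integral_cpow_mul_exp_neg_mul_Ioi ha hr
  rw [← integral_comp_rpow_Ioi _ (two_ne_zero : (2 : ℝ) ≠ 0)] at h
  have e : ((1 : ℂ) / r) ^ a = (r : ℂ) ^ (-a) := by
    rw [one_div, Complex.inv_cpow, Complex.cpow_neg]
    rw [Complex.arg_ofReal_of_nonneg hr.le]
    exact Real.pi_pos.ne
  rw [← e, ← h, ← integral_div]
  refine setIntegral_congr_fun measurableSet_Ioi fun s hs => ?_
  have hs : 0 < s := hs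
  have hs0 : (s : ℂ) ≠ 0 := by exact_mod_cast hs.ne'
  have h2 : (((s ^ (2 : ℝ) : ℝ) : ℂ)) = (s : ℂ) ^ 2 := by
    rw [Real.rpow_two, Complex.ofReal_pow]
  have h3 : ((s : ℂ) ^ 2) ^ (a - 1) = (s : ℂ) ^ (2 * a - 2) := by
    rw [← Complex.ofReal_pow, pow_two, Complex.ofReal_mul,
      Complex.mul_cpow_ofReal_nonneg hs.le hs.le, ← Complex.cpow_add _ _ hs0]
    ring_nf
  have h4 : (s : ℂ) ^ (2 * a - 1) = s * (s : ℂ) ^ (2 * a - 2) := by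
    rw [show 2 * a - 1 = 1 + (2 * a - 2) by ring, Complex.cpow_add _ _ hs0, Complex.cpow_one]
  simp only [h2, h3, h4, Complex.real_smul]
  norm_num
  ring

open MeasureTheory in
theorem gaussian_moment {a r : ℂ} (ha : 0 < a.re) (hr : 0 < r.re) :
    ∫ s in Set.Ioi (0 : ℝ), (s : ℂ) ^ (2 * a - 1) * Complex.exp (-r * (s : ℂ) ^ 2)
      = r ^ (-a) * Complex.Gamma a / 2 := by
  have hopen : IsOpen {r : ℂ | 0 < r.re} := isOpen_lt continuous_const Complex.continuous_re
  have h1 := (differentiableOn_gaussian_moment ha).analyticOnNhd hopen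
  have h2 : AnalyticOnNhd ℂ (fun r : ℂ => r ^ (-a) * Complex.Gamma a / 2) {r | 0 < r.re} := by
    refine DifferentiableOn.analyticOnNhd (fun r hr => ?_) hopen
    refine DifferentiableAt.differentiableWithinAt ?_
    exact ((((hasDerivAt_id r).cpow_const (Or.inl hr)).mul_const _).div_const _).differentiableAt
  refine h1.eqOn_of_preconnected_of_frequently_eq h2 (convex_halfSpace_re_gt 0).isPreconnected
    (z₀ := 1) (by simp) ?_ hr
  have ht : Tendsto (fun x : ℝ => (x : ℂ)) (𝓝[≠] 1) (𝓝[≠] 1) := by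
    refine tendsto_nhdsWithin_iff.2 ⟨?_, ?_⟩
    · exact (Complex.continuous_ofReal.tendsto' 1 1 (by simp)).mono_left nhdsWithin_le_nhds
    · filter_upwards [self_mem_nhdsWithin] with x hx
      simpa using hx
  refine ht.frequently (Eventually.frequently ?_)
  filter_upwards [nhdsWithin_le_nhds (lt_mem_nhds (zero_lt_one : (0 : ℝ) < 1))] with x hx
  exact gaussian_moment_of_real ha hx

theorem Gamma_add_natCast_eq_pochC {a : ℂ} (ha : 0 < a.re) (n : ℕ) :
    Complex.Gamma (a + n) = pochC a n * Complex.Gamma a := by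
  induction n with
  | zero => simp [pochC]
  | succ n ih =>
    have h0 : a + n ≠ 0 := fun h => by
      have := congrArg Complex.re h
      simp at this
      linarith [(n.cast_nonneg : (0 : ℝ) ≤ n)]
    rw [Nat.cast_succ, ← add_assoc, Complex.Gamma_add_one _ h0, ih, pochC_succ]
    ring

theorem factorial_two_mul_eq_pochC (n : ℕ) :
    ((2 * n).factorial : ℂ) = pochC (1 / 2) n * 4 ^ n * n.factorial := by
  induction n with
  | zero => simp [pochC]
  | succ n ih =>
    rw [show 2 * (n + 1) = 2 * n + 1 + 1 by ring, Nat.factorial_succ, Nat.factorial_succ,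
      Nat.factorial_succ, pochC_succ]
    push_cast
    rw [ih]
    ring

open MeasureTheory in
/-- A Gaussian integral representation of `M(a, 1/2, r z²)`. -/
theorem integral_gaussian_mul_cosh {a r : ℂ} (ha : 0 < a.re) (hr : 0 < r.re) (z : ℝ) :
    ∫ s in Set.Ioi (0 : ℝ), (s : ℂ) ^ (2 * a - 1) * Complex.exp (-r * (s : ℂ) ^ 2) *
        Complex.cosh (2 * r * z * s)
      = r ^ (-a) * Complex.Gamma a / 2 * kummerM a (1 / 2) (r * (z : ℂ) ^ 2) := by
  have hr0 : r ≠ 0 := fun h => by simp [h] at hr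
  set k : ℝ := ‖2 * r * (z : ℂ)‖ with hk
  set g : ℝ → ℝ := fun s => s ^ (2 * a.re - 1) * Real.exp (-r.re * s ^ 2) with hg
  have hbound : ∀ s : ℝ, HasSum (fun n : ℕ => g s * ((k * s) ^ (2 * n) / ((2 * n).factorial : ℝ)))
      (g s * Real.cosh (k * s)) := fun s => (Real.hasSum_cosh _).mul_left _
  have hs := hasSum_integral_of_dominated_convergence (μ := volume.restrict (Set.Ioi (0 : ℝ)))
    (F := fun (n : ℕ) (s : ℝ) => (s : ℂ) ^ (2 * a - 1) * Complex.exp (-r * (s : ℂ) ^ 2) *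
      ((2 * r * z * s) ^ (2 * n) / ((2 * n).factorial : ℂ)))
    (f := fun s : ℝ => (s : ℂ) ^ (2 * a - 1) * Complex.exp (-r * (s : ℂ) ^ 2) *
        Complex.cosh (2 * r * z * s))
    (fun (n : ℕ) (s : ℝ) => g s * ((k * s) ^ (2 * n) / ((2 * n).factorial : ℝ)))
    (fun n => Measurable.aestronglyMeasurable (by fun_prop)) ?_
    (Eventually.of_forall fun s => (hbound s).summable) ?_
    (Eventually.of_forall fun s => (Complex.hasSum_cosh _).mul_left _)
  · refine hs.unique ?_
    convert! (hasSum_kummerM a (c := 1 / 2) (by norm_num) (r * (z : ℂ) ^ 2)).mul_left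
      (r ^ (-a) * Complex.Gamma a / 2) using 2 with n
    have h1 : ∫ s in Set.Ioi (0 : ℝ), (s : ℂ) ^ (2 * a - 1) * Complex.exp (-r * (s : ℂ) ^ 2) *
        ((2 * r * z * s) ^ (2 * n) / ((2 * n).factorial : ℂ))
        = (2 * r * z) ^ (2 * n) / ((2 * n).factorial : ℂ) * ∫ s in Set.Ioi (0 : ℝ),
          (s : ℂ) ^ (2 * (a + n) - 1) * Complex.exp (-r * (s : ℂ) ^ 2) := by
      rw [← integral_const_mul]
      refine setIntegral_congr_fun measurableSet_Ioi fun s hs => ?_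
      have hs : 0 < s := hs
      have hs0 : (s : ℂ) ≠ 0 := by exact_mod_cast hs.ne'
      have : (s : ℂ) ^ (2 * (a + n) - 1) = (s : ℂ) ^ (2 * a - 1) * (s : ℂ) ^ (2 * n) := by
        rw [← Complex.cpow_natCast, ← Complex.cpow_add _ _ hs0]
        congr 1
        push_cast
        ring
      simp only [this, mul_pow _ (s : ℂ)]
      ring
    have h2 : 0 < (a + n).re := by
      rw [Complex.add_re, Complex.natCast_re]
      positivity
    rw [h1, gaussian_moment h2 hr, Gamma_add_natCast_eq_pochC ha, factorial_two_mul_eq_pochC,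
      neg_add, Complex.cpow_add _ _ hr0, Complex.cpow_neg r n, Complex.cpow_natCast]
    have h3 : pochC (1 / 2) n ≠ 0 := Finset.prod_ne_zero_iff.2 fun i _ h => by
      have := congrArg Complex.re h
      simp at this
      linarith [(i.cast_nonneg : (0 : ℝ) ≤ i)]
    have h4 : (n.factorial : ℂ) ≠ 0 := by exact_mod_cast n.factorial_ne_zero
    have h5 : (2 * r * (z : ℂ)) ^ (2 * n) = 4 ^ n * r ^ n * (r ^ n * (z : ℂ) ^ (2 * n)) := by
      rw [mul_pow, mul_pow, pow_mul 2 2 n, mul_comm 2 n, pow_mul r n 2]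
      norm_num
      ring
    rw [h5, mul_pow, ← pow_mul]
    have h6 : r ^ n ≠ 0 := pow_ne_zero _ hr0
    have h7 : (4 : ℂ) ^ n ≠ 0 := pow_ne_zero _ (by norm_num)
    field_simp
  · intro n
    filter_upwards [ae_restrict_mem measurableSet_Ioi] with s hs
    have hs : 0 < s := hs
    rw [norm_mul, norm_mul, Complex.norm_cpow_eq_rpow_re_of_pos hs, Complex.norm_exp,
      ← Complex.ofReal_pow, Complex.re_mul_ofReal, norm_div, norm_pow, norm_mul, ← hk,
      Complex.norm_natCast, Complex.norm_of_nonneg hs.le]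
    simp [hg]
  · simp_rw [(hbound _).tsum_eq]
    have hi := fun k' => integrableOn_rpow_mul_exp_quadratic (s := 2 * a.re - 1) hr
      (by linarith) k'
    refine (((hi k).add (hi (-k))).div_const 2).congr (Eventually.of_forall fun s => ?_)
    simp only [Pi.add_apply, hg, Real.cosh_eq, Real.exp_add, neg_mul]
    ring

theorem ofReal_mul_cpow {x : ℝ} (hx : 0 < x) {w : ℂ} (hw : w ≠ 0) (γ : ℂ) :
    ((x : ℂ) * w) ^ γ = (x : ℂ) ^ γ * w ^ γ := by
  have h0 : (x : ℂ) ≠ 0 := by exact_mod_cast hx.ne'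
  rw [Complex.cpow_def_of_ne_zero (mul_ne_zero h0 hw), Complex.cpow_def_of_ne_zero h0,
    Complex.cpow_def_of_ne_zero hw, ← Complex.exp_add, Complex.log_ofReal_mul hx hw,
    Complex.ofReal_log hx.le, add_mul]

open MeasureTheory in
theorem tendsto_integral_abs_cpow_mul_gaussian {a r : ℂ} (ha : 1 / 2 < a.re) (hr : 0 < r.re) :
    (∀ z : ℝ, 1 ≤ z → Integrable fun v : ℝ =>
      ((|1 + v / z| : ℝ) : ℂ) ^ (2 * a - 1) * Complex.exp (-r * (v : ℂ) ^ 2)) ∧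
    Tendsto (fun z : ℝ => ∫ v : ℝ,
      ((|1 + v / z| : ℝ) : ℂ) ^ (2 * a - 1) * Complex.exp (-r * (v : ℂ) ^ 2)) atTop
      (𝓝 ((Real.pi / r) ^ (1 / 2 : ℂ))) := by
  set p : ℝ := 2 * a.re - 1 with hp
  have hp0 : 0 < p := by linarith
  set B : ℝ → ℝ := fun v => Real.exp (p ^ 2 / (2 * r.re)) * Real.exp (-(r.re / 2) * v ^ 2) with hB
  have hBi : Integrable B := (integrable_exp_neg_mul_sq (half_pos hr)).const_mul _
  have hmeas : ∀ z : ℝ, AEStronglyMeasurable (fun v : ℝ =>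
      ((|1 + v / z| : ℝ) : ℂ) ^ (2 * a - 1) * Complex.exp (-r * (v : ℂ) ^ 2)) volume := fun z =>
    Measurable.aestronglyMeasurable (by fun_prop)
  have hle : ∀ z : ℝ, 1 ≤ z → ∀ v : ℝ,
      ‖((|1 + v / z| : ℝ) : ℂ) ^ (2 * a - 1) * Complex.exp (-r * (v : ℂ) ^ 2)‖ ≤ B v := by
    intro z hz v
    have hre : (2 * a - 1).re = p := by simp [hp]
    rw [norm_mul, Complex.norm_cpow_eq_rpow_re_of_nonneg (abs_nonneg _) (by rw [hre]; exact hp0.ne'),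
      hre, Complex.norm_exp, ← Complex.ofReal_pow, Complex.re_mul_ofReal, Complex.neg_re]
    have h1 : |1 + v / z| ≤ Real.exp |v| := by
      have h2 : |v / z| ≤ |v| := by
        rw [abs_div, abs_of_pos (by linarith : (0 : ℝ) < z)]
        exact div_le_self (abs_nonneg _) hz
      have h3 := abs_add_le 1 (v / z)
      rw [abs_one] at h3
      linarith [Real.add_one_le_exp |v|]
    have h4 : |1 + v / z| ^ p ≤ Real.exp (|v| * p) := by
      rw [Real.exp_mul]
      exact Real.rpow_le_rpow (abs_nonneg _) h1 hp0.le
    refine (mul_le_mul_of_nonneg_right h4 (Real.exp_pos _).le).trans ?_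
    rw [hB]
    simp only
    rw [← Real.exp_add, ← Real.exp_add, Real.exp_le_exp]
    have h5 : 0 ≤ (r.re * |v| - p) ^ 2 / (2 * r.re) := by positivity
    have e : (r.re * |v| - p) ^ 2 / (2 * r.re) =
        p ^ 2 / (2 * r.re) + r.re / 2 * |v| ^ 2 - |v| * p := by
      field_simp
      ring
    rw [sq_abs] at e
    linarith
  refine ⟨fun z hz => hBi.mono' (hmeas z) (Eventually.of_forall (hle z hz)), ?_⟩
  rw [← integral_gaussian_complex hr]
  refine tendsto_integral_filter_of_dominated_convergence B (Eventually.of_forall hmeas)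
    ((eventually_ge_atTop 1).mono fun z hz => Eventually.of_forall (hle z hz)) hBi
    (Eventually.of_forall fun v => ?_)
  have h1 : Tendsto (fun z : ℝ => |1 + v / z|) atTop (𝓝 1) := by
    have := ((tendsto_const_nhds (x := (1 : ℝ))).add
      (tendsto_id.const_div_atTop v : Tendsto (fun z : ℝ => v / z) atTop (𝓝 0))).abs
    simpa using this
  have h2 := ((Complex.continuousAt_ofReal_cpow_const 1 (2 * a - 1)
    (Or.inr one_ne_zero)).tendsto.comp h1).mul_const (Complex.exp (-r * (v : ℂ) ^ 2))
  simpa using h2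

open MeasureTheory in
theorem integral_gaussian_mul_cosh_eq_shift {a r : ℂ} (ha : 1 / 2 < a.re) (hr : 0 < r.re) {z : ℝ}
    (hz : 1 ≤ z) :
    ∫ s in Set.Ioi (0 : ℝ), (s : ℂ) ^ (2 * a - 1) * Complex.exp (-r * (s : ℂ) ^ 2) *
        Complex.cosh (2 * r * z * s)
      = gaussPow r (2 * a - 1) z / 2 * ∫ v : ℝ,
        ((|1 + v / z| : ℝ) : ℂ) ^ (2 * a - 1) * Complex.exp (-r * (v : ℂ) ^ 2) := by
  have hz0 : 0 < z := by linarith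
  set f : ℝ → ℂ := fun x => ((|x| : ℝ) : ℂ) ^ (2 * a - 1) * Complex.exp (-r * ((x : ℂ) - z) ^ 2)
    with hf
  have hshift : ∀ x : ℝ, (z : ℂ) ^ (2 * a - 1) * (((|1 + (x - z) / z| : ℝ) : ℂ) ^ (2 * a - 1) *
      Complex.exp (-r * ((x - z : ℝ) : ℂ) ^ 2)) = f x := by
    intro x
    rw [← mul_assoc, ← Complex.mul_cpow_ofReal_nonneg hz0.le (abs_nonneg _), ← Complex.ofReal_mul]
    nth_rewrite 1 [← abs_of_pos hz0]
    rw [← abs_mul, mul_add, mul_div_cancel₀ _ hz0.ne', mul_one, add_sub_cancel, Complex.ofReal_sub]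
  have hfi : Integrable f := by
    refine ((((tendsto_integral_abs_cpow_mul_gaussian ha hr).1 z hz).comp_sub_right z).const_mul
      ((z : ℂ) ^ (2 * a - 1))).congr (Eventually.of_forall hshift)
  have h1 : ∫ x, f x = (z : ℂ) ^ (2 * a - 1) * ∫ v : ℝ,
      ((|1 + v / z| : ℝ) : ℂ) ^ (2 * a - 1) * Complex.exp (-r * (v : ℂ) ^ 2) := by
    rw [← integral_sub_right_eq_self (fun v : ℝ =>
      ((|1 + v / z| : ℝ) : ℂ) ^ (2 * a - 1) * Complex.exp (-r * (v : ℂ) ^ 2)) z,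
      ← integral_const_mul]
    exact integral_congr_ae (Eventually.of_forall fun x => (hshift x).symm)
  have h2 : ∫ x, f x = ∫ x in Set.Ioi (0 : ℝ), (f (-x) + f x) := by
    rw [← intervalIntegral.integral_Iic_add_Ioi (b := 0) hfi.integrableOn hfi.integrableOn,
      integral_add hfi.comp_neg.integrableOn hfi.integrableOn, integral_comp_neg_Ioi, neg_zero]
  rw [gaussPow, mul_div_right_comm, mul_assoc (Complex.exp _ / 2), ← h1, h2, ← integral_const_mul]
  refine setIntegral_congr_fun measurableSet_Ioi fun s hs => ?_
  have hs : 0 < s := hs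
  simp only [hf, abs_neg, abs_of_pos hs, Complex.cosh]
  have e1 : Complex.exp (-r * (((-s : ℝ) : ℂ) - z) ^ 2) = Complex.exp (-r * (s : ℂ) ^ 2) *
      Complex.exp (-(2 * r * z * s)) * (Complex.exp (r * (z : ℂ) ^ 2))⁻¹ := by
    rw [← Complex.exp_neg, ← Complex.exp_add, ← Complex.exp_add]
    congr 1
    push_cast
    ring
  have e2 : Complex.exp (-r * ((s : ℂ) - z) ^ 2) = Complex.exp (-r * (s : ℂ) ^ 2) *
      Complex.exp (2 * r * z * s) * (Complex.exp (r * (z : ℂ) ^ 2))⁻¹ := by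
    rw [← Complex.exp_neg, ← Complex.exp_add, ← Complex.exp_add]
    congr 1
    ring
  have := Complex.exp_ne_zero (r * (z : ℂ) ^ 2)
  rw [e1, e2]
  field_simp
  ring

theorem hasGaussAsymp_kummerM_half_of_re {a r : ℂ} (ha : 1 / 2 < a.re) (hr : 0 < r.re) :
    HasGaussAsymp r (2 * a - 1) (Complex.Gamma (1 / 2) / Complex.Gamma a * r ^ (a - 1 / 2))
      (fun z => kummerM a (1 / 2) (r * (z : ℂ) ^ 2)) := by
  have ha0 : 0 < a.re := by linarith
  have hr0 : r ≠ 0 := fun h => by simp [h] at hr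
  have hG : Complex.Gamma a ≠ 0 := Complex.Gamma_ne_zero_of_re_pos ha0
  have hra : r ^ a ≠ 0 := by simp [Complex.cpow_eq_zero_iff, hr0]
  have hC : Complex.Gamma (1 / 2) / Complex.Gamma a * r ^ (a - 1 / 2) =
      r ^ a / Complex.Gamma a * (Real.pi / r) ^ (1 / 2 : ℂ) := by
    have harg : r.arg ≠ Real.pi := fun h => by
      have := (Complex.arg_eq_pi_iff.1 h).1
      linarith
    rw [Complex.Gamma_one_half_eq, div_eq_mul_inv (Real.pi : ℂ),
      ofReal_mul_cpow Real.pi_pos (inv_ne_zero hr0), Complex.inv_cpow _ _ harg,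
      Complex.cpow_sub _ _ hr0]
    ring
  rw [hC]
  refine ((tendsto_integral_abs_cpow_mul_gaussian ha hr).2.const_mul
    (r ^ a / Complex.Gamma a)).congr' ?_
  filter_upwards [eventually_ge_atTop 1] with z hz
  have hg := gaussPow_ne_zero r (2 * a - 1) (by linarith : (0 : ℝ) < z)
  have h := (integral_gaussian_mul_cosh ha0 hr z).symm.trans
    (integral_gaussian_mul_cosh_eq_shift ha hr hz)
  rw [Complex.cpow_neg] at h
  rw [eq_div_iff hg]
  field_simp at h ⊢
  rw [h]

/-- Leading asymptotics of `M(a, 1/2, r z²)` as `z → ∞` for `0 < re r`. -/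
theorem hasGaussAsymp_kummerM_half {a r : ℂ} (ha : ∀ n : ℕ, a ≠ -n) (hr : 0 < r.re) :
    HasGaussAsymp r (2 * a - 1) (Complex.Gamma (1 / 2) / Complex.Gamma a * r ^ (a - 1 / 2))
      (fun z => kummerM a (1 / 2) (r * (z : ℂ) ^ 2)) := by
  have hr0 : r ≠ 0 := fun h => by simp [h] at hr
  obtain ⟨N, hN⟩ := exists_nat_gt (1 / 2 - a.re)
  induction N generalizing a with
  | zero => exact hasGaussAsymp_kummerM_half_of_re (by rw [Nat.cast_zero] at hN; linarith) hr
  | succ N ih =>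
    have ha0 : a ≠ 0 := by simpa using ha 0
    have h1 := ih (a := a + 1) (fun n h => ha (n + 1) (by push_cast; linear_combination h))
      (by push_cast at hN; rw [Complex.add_re, Complex.one_re]; linarith)
    have h2 : HasGaussAsymp r (4 * a) (2 * a *
        (Complex.Gamma (1 / 2) / Complex.Gamma (a + 1) * r ^ (a + 1 - 1 / 2))) (fun z : ℝ =>
          2 * a * (z : ℂ) ^ (2 * a - 1) * kummerM (a + 1) (1 / 2) (r * (z : ℂ) ^ 2)) := by
      refine h1.congr_mul fun z hz => ?_
      have h0 : (z : ℂ) ≠ 0 := by exact_mod_cast hz.ne'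
      rw [show 4 * a = 2 * (a + 1) - 1 + (2 * a - 1) by ring, ← gaussPow_mul_cpow _ _ _ hz]
      have := gaussPow_ne_zero r (2 * (a + 1) - 1) hz
      have : (z : ℂ) ^ (2 * a - 1) ≠ 0 := by simp [Complex.cpow_eq_zero_iff, h0]
      field_simp
    have h3 := h2.of_hasDerivAt hr fun z hz =>
      hasDerivAt_cpow_mul_kummerM a (c := 1 / 2) (by norm_num) r hz
    have h4 := h3.congr_mul (g := fun z => kummerM a (1 / 2) (r * (z : ℂ) ^ 2)) (β' := r)
      (γ' := 2 * a - 1) (c := 1) fun z hz => by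
        have h0 : (z : ℂ) ≠ 0 := by exact_mod_cast hz.ne'
        rw [show 4 * a - 1 = 2 * a - 1 + 2 * a by ring, ← gaussPow_mul_cpow _ _ _ hz]
        have := gaussPow_ne_zero r (2 * a - 1) hz
        have : (z : ℂ) ^ (2 * a) ≠ 0 := by simp [Complex.cpow_eq_zero_iff, h0]
        field_simp
    convert h4 using 1
    have hG : Complex.Gamma a ≠ 0 := Complex.Gamma_ne_zero ha
    rw [Complex.Gamma_add_one _ ha0, show a + 1 - 1 / 2 = a - 1 / 2 + 1 by ring,
      Complex.cpow_add _ _ hr0, Complex.cpow_one]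
    field_simp

theorem HasGaussAsymp.mul_exp_neg {b γ C : ℂ} {f : ℝ → ℂ} (hf : HasGaussAsymp (b ^ 2) γ C f) :
    HasGaussAsymp (b ^ 2 / 2) γ C (fun z => f z * Complex.exp (-(b * (z : ℂ)) ^ 2 / 2)) := by
  rw [← one_mul C]
  refine hf.congr_mul fun z hz => ?_
  have e : Complex.exp (-(b * (z : ℂ)) ^ 2 / 2) =
      Complex.exp (b ^ 2 / 2 * (z : ℂ) ^ 2) * (Complex.exp (b ^ 2 * (z : ℂ) ^ 2))⁻¹ := by
    rw [← Complex.exp_neg, ← Complex.exp_add]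
    congr 1
    ring
  rw [gaussPow, gaussPow, e, one_mul]
  have h1 := Complex.exp_ne_zero (b ^ 2 / 2 * (z : ℂ) ^ 2)
  have h2 := Complex.exp_ne_zero (b ^ 2 * (z : ℂ) ^ 2)
  field_simp

theorem HasGaussAsymp.integral_pow_mul {β γ C r : ℂ} {φ : ℝ → ℂ} (hφ : Continuous φ)
    (hβ : 0 < β.re) (h : HasGaussAsymp β γ C φ) (m : ℕ) :
    HasGaussAsymp β (γ + 2 * m - 1) (r ^ m * C / (2 * β))
      (fun z => ∫ t in (0 : ℝ)..z, (r * (t : ℂ) ^ 2) ^ m * φ t) := by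
  have h1 : HasGaussAsymp β (γ + 2 * m) (r ^ m * C)
      (fun t : ℝ => (r * (t : ℂ) ^ 2) ^ m * φ t) := by
    refine h.congr_mul fun z hz => ?_
    have h0 : (z : ℂ) ≠ 0 := by exact_mod_cast hz.ne'
    rw [← gaussPow_mul_cpow _ _ _ hz, mul_pow, ← pow_mul, ← Complex.cpow_natCast (z : ℂ) (2 * m)]
    push_cast
    have := gaussPow_ne_zero β γ hz
    have : (z : ℂ) ^ (2 * m : ℂ) ≠ 0 := by simp [Complex.cpow_eq_zero_iff, h0]
    field_simp
  have hc : Continuous (fun t : ℝ => (r * (t : ℂ) ^ 2) ^ m * φ t) := by fun_prop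
  exact h1.of_hasDerivAt hβ fun z _ => hc.integral_hasStrictDerivAt 0 z |>.hasDerivAt

theorem exp_mul_cpow_eq_gaussPow {r : ℂ} (hr : r ≠ 0) (κ : ℂ) {z : ℝ} (hz : 0 < z) :
    Complex.exp (r * (z : ℂ) ^ 2 / 2) * (r * (z : ℂ) ^ 2) ^ κ =
      r ^ κ * gaussPow (r / 2) (2 * κ) z := by
  have h0 : (z : ℂ) ≠ 0 := by exact_mod_cast hz.ne'
  rw [mul_comm r, ← Complex.ofReal_pow, ofReal_mul_cpow (by positivity) hr, gaussPow, pow_two,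
    Complex.ofReal_mul, Complex.mul_cpow_ofReal_nonneg hz.le hz.le, ← Complex.cpow_add _ _ h0,
    ← two_mul, show (z : ℂ) * z * r / 2 = r / 2 * (z : ℂ) ^ 2 by ring]
  ring

theorem integral_neg_of_parity {f : ℝ → ℂ} {σ : ℂ} (hf : ∀ z, f (-z) = σ * f z) (z : ℝ) :
    ∫ t in (0 : ℝ)..(-z), f t = -σ * ∫ t in (0 : ℝ)..z, f t := by
  have h := intervalIntegral.integral_comp_neg (a := 0) (b := z) f
  simp only [hf, intervalIntegral.integral_const_mul, neg_zero] at h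
  rw [intervalIntegral.integral_symm, ← h, neg_mul]

theorem isEquivalent_atTop_atBot_of_parity {f g : ℝ → ℂ} {σ : ℂ} (hσ : σ ≠ 0)
    (hf : ∀ z, f (-z) = σ * f z) (hg : ∀ z, g (-z) = σ * g z) (h : IsEquivalent atTop f g)
    {l : Filter ℝ} (hl : l ∈ ({atTop, atBot} : Set (Filter ℝ))) : IsEquivalent l f g := by
  rcases hl with rfl | rfl
  · exact h
  · exact isEquivalent_atBot_of_parity σ hσ hf hg h

theorem psi1_neg (μ η : ℂ) : psi1 μ (-η) = psi1 μ η := by simp [psi1]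

theorem psi2_neg (μ η : ℂ) : psi2 μ (-η) = -psi2 μ η := by simp [psi2]

theorem continuous_psi1 (μ : ℂ) : Continuous (psi1 μ) := by
  have := (differentiable_kummerM (-(1 + μ) / 4) (c := 1 / 2) (by norm_num)).continuous
  unfold psi1
  fun_prop

theorem continuous_psi2 (μ : ℂ) : Continuous (psi2 μ) := by
  have := (differentiable_kummerM ((1 - μ) / 4) (c := 3 / 2) (by norm_num)).continuous
  unfold psi2
  fun_prop

theorem hasGaussAsymp_psi1 {b μ : ℂ} (hb : 0 < (b ^ 2).re) (hμ : ∀ n : ℤ, μ ≠ 2 * (n : ℂ) + 1) :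
    HasGaussAsymp (b ^ 2 / 2) (-(μ + 3) / 2)
      (Complex.Gamma (1 / 2) / Complex.Gamma (-(μ + 1) / 4) * (b ^ 2) ^ (-(μ + 3) / 4))
      (fun z => psi1 μ (b * (z : ℂ))) := by
  have h := (hasGaussAsymp_kummerM_half (a := -(1 + μ) / 4) (fun n h => hμ (2 * n - 1) (by
    push_cast
    linear_combination -4 * h)) hb).mul_exp_neg
  convert! h using 1
  · ring
  · rw [add_comm μ 1, show -(1 + μ) / 4 - 1 / 2 = -(μ + 3) / 4 by ring]
  · funext z
    rw [psi1, mul_pow]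

theorem hasGaussAsymp_psi2 {b μ : ℂ} (hb : 0 < (b ^ 2).re) (hμ : ∀ n : ℤ, μ ≠ 2 * (n : ℂ) + 1) :
    HasGaussAsymp (b ^ 2 / 2) (-(μ + 3) / 2)
      (b * (Complex.Gamma (3 / 2) / Complex.Gamma ((1 - μ) / 4) * (b ^ 2) ^ (-(μ + 5) / 4)))
      (fun z => psi2 μ (b * (z : ℂ))) := by
  have hr0 : b ^ 2 ≠ 0 := fun h => by simp [h] at hb
  have h1 := ((hasGaussAsymp_kummerM_half (a := (1 - μ) / 4) (fun n h => hμ (2 * n) (by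
    push_cast
    linear_combination -4 * h)) hb).of_hasDerivAt hb fun z _ =>
      hasDerivAt_mul_kummerM_three_half ((1 - μ) / 4) (b ^ 2) z).mul_exp_neg
  have h2 := h1.congr_mul (g := fun z : ℝ => psi2 μ (b * (z : ℂ))) (β' := b ^ 2 / 2)
    (γ' := 2 * ((1 - μ) / 4) - 1 - 1) (c := b) fun z _ => by
      rw [psi2, mul_pow]
      ring
  convert! h2 using 1
  · ring
  · rw [show (3 / 2 : ℂ) = 1 / 2 + 1 by norm_num, Complex.Gamma_add_one _ (by norm_num),
      show (1 - μ) / 4 - 1 / 2 = -(μ + 5) / 4 + 1 by ring, Complex.cpow_add _ _ hr0,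
      Complex.cpow_one]
    field_simp

theorem re_sq_pos_of_eq_exp {b : ℂ} (hb : b = Complex.exp (Complex.I * ((Real.pi / 8 : ℝ) : ℂ))
    ∨ b = Complex.exp (-(Complex.I * ((Real.pi / 8 : ℝ) : ℂ)))) : 0 < (b ^ 2).re := by
  have hcos : 0 < Real.cos (2 * (Real.pi / 8)) :=
    Real.cos_pos_of_mem_Ioo ⟨by linarith [Real.pi_pos], by linarith [Real.pi_pos]⟩
  rcases hb with rfl | rfl <;> rw [← Complex.exp_nat_mul, Complex.exp_re] <;> simpa using hcos

theorem statement13 (b : ℂ)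
    (hb : b = Complex.exp (Complex.I * ((Real.pi / 8 : ℝ) : ℂ))
        ∨ b = Complex.exp (-(Complex.I * ((Real.pi / 8 : ℝ) : ℂ))))
    (μ : ℂ) (hμ : ∀ n : ℤ, μ ≠ 2 * (n : ℂ) + 1)
    (m : ℕ) (hm : m = 0 ∨ m = 1) :
    (∀ l ∈ ({atTop, atBot} : Set (Filter ℝ)),
      IsEquivalent l
        (fun z : ℝ => psi1 μ (b * (z : ℂ)))
        (fun z : ℝ => Complex.Gamma (1 / 2) / Complex.Gamma (-(μ + 1) / 4)
          * Complex.exp (b ^ 2 * (z : ℂ) ^ 2 / 2) * (b ^ 2 * (z : ℂ) ^ 2) ^ (-(μ + 3) / 4)) ∧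
      IsEquivalent l
        (fun z : ℝ => ∫ t in (0:ℝ)..z, (b ^ 2 * (t : ℂ) ^ 2) ^ m * psi1 μ (b * (t : ℂ)))
        (fun z : ℝ => Complex.Gamma (1 / 2) / Complex.Gamma (-(μ + 1) / 4) / b
          * Complex.exp (b ^ 2 * (z : ℂ) ^ 2 / 2)
          * (b ^ 2 * (z : ℂ) ^ 2) ^ ((m : ℂ) - (μ + 3) / 4) / (b * (z : ℂ))) ∧
      IsEquivalent l
        (fun z : ℝ => psi2 μ (b * (z : ℂ)))
        (fun z : ℝ => Complex.Gamma (3 / 2) / Complex.Gamma ((1 - μ) / 4)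
          * Complex.exp (b ^ 2 * (z : ℂ) ^ 2 / 2) * (b ^ 2 * (z : ℂ) ^ 2) ^ (-(μ + 5) / 4)
          * (b * (z : ℂ))) ∧
      IsEquivalent l
        (fun z : ℝ => ∫ t in (0:ℝ)..z, (b ^ 2 * (t : ℂ) ^ 2) ^ m * psi2 μ (b * (t : ℂ)))
        (fun z : ℝ => Complex.Gamma (3 / 2) / Complex.Gamma ((1 - μ) / 4) / b
          * Complex.exp (b ^ 2 * (z : ℂ) ^ 2 / 2)
          * (b ^ 2 * (z : ℂ) ^ 2) ^ ((m : ℂ) - (μ + 5) / 4))) := by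
  have hre := re_sq_pos_of_eq_exp hb
  have hr0 : b ^ 2 ≠ 0 := fun h => by simp [h] at hre
  have hb0 : b ≠ 0 := fun h => hr0 (by simp [h])
  have hre2 : 0 < (b ^ 2 / 2).re := by simpa using hre
  have hpow : ∀ κ : ℂ, (b ^ 2) ^ κ ≠ 0 := fun κ => by simp [Complex.cpow_eq_zero_iff, hr0]
  have hG1 : Complex.Gamma (1 / 2) / Complex.Gamma (-(μ + 1) / 4) ≠ 0 :=
    div_ne_zero (Complex.Gamma_ne_zero_of_re_pos (by norm_num))
      (Complex.Gamma_ne_zero fun n h => hμ (2 * n - 1) (by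
        push_cast
        linear_combination -4 * h))
  have hG2 : Complex.Gamma (3 / 2) / Complex.Gamma ((1 - μ) / 4) ≠ 0 :=
    div_ne_zero (Complex.Gamma_ne_zero_of_re_pos (by norm_num))
      (Complex.Gamma_ne_zero fun n h => hμ (2 * n) (by
        push_cast
        linear_combination -4 * h))
  have h1 := hasGaussAsymp_psi1 hre hμ
  have h2 := hasGaussAsymp_psi2 hre hμ
  have hc1 : Continuous fun z : ℝ => psi1 μ (b * (z : ℂ)) :=
    (continuous_psi1 μ).comp (by fun_prop)
  have hc2 : Continuous fun z : ℝ => psi2 μ (b * (z : ℂ)) :=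
    (continuous_psi2 μ).comp (by fun_prop)
  have h3 := h1.integral_pow_mul (r := b ^ 2) hc1 hre2 m
  have h4 := h2.integral_pow_mul (r := b ^ 2) hc2 hre2 m
  intro l hl
  refine ⟨isEquivalent_atTop_atBot_of_parity one_ne_zero (fun z => ?_) (fun z => ?_)
      (h1.isEquivalent (mul_ne_zero hG1 (hpow _)) fun z hz => ?_) hl,
    isEquivalent_atTop_atBot_of_parity (neg_ne_zero.2 one_ne_zero)
      (integral_neg_of_parity fun z => ?_) (fun z => ?_)
      (h3.isEquivalent (div_ne_zero (mul_ne_zero (pow_ne_zero _ hr0)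
        (mul_ne_zero hG1 (hpow _))) (mul_ne_zero two_ne_zero (div_ne_zero hr0 two_ne_zero)))
        fun z hz => ?_) hl,
    isEquivalent_atTop_atBot_of_parity (neg_ne_zero.2 one_ne_zero) (fun z => ?_) (fun z => ?_)
      (h2.isEquivalent (mul_ne_zero hb0 (mul_ne_zero hG2 (hpow _))) fun z hz => ?_) hl,
    isEquivalent_atTop_atBot_of_parity (neg_ne_zero.2 (neg_ne_zero.2 one_ne_zero))
      (integral_neg_of_parity fun z => ?_) (fun z => ?_)
      (h4.isEquivalent (div_ne_zero (mul_ne_zero (pow_ne_zero _ hr0)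
        (mul_ne_zero hb0 (mul_ne_zero hG2 (hpow _))))
        (mul_ne_zero two_ne_zero (div_ne_zero hr0 two_ne_zero))) fun z hz => ?_) hl⟩
  · rw [Complex.ofReal_neg, mul_neg, psi1_neg, one_mul]
  · rw [Complex.ofReal_neg, neg_sq, one_mul]
  · rw [mul_assoc _ (Complex.exp _), exp_mul_cpow_eq_gaussPow hr0 _ hz]
    ring_nf
  · rw [Complex.ofReal_neg, mul_neg, psi1_neg, neg_sq, one_mul]
  · rw [Complex.ofReal_neg, neg_sq, mul_neg, div_neg, neg_one_mul]
  · have h0 : (z : ℂ) ≠ 0 := by exact_mod_cast hz.ne'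
    rw [mul_assoc _ (Complex.exp _), exp_mul_cpow_eq_gaussPow hr0 _ hz,
      show (m : ℂ) - (μ + 3) / 4 = -(μ + 3) / 4 + m by ring, Complex.cpow_add _ _ hr0,
      Complex.cpow_natCast,
      show 2 * (-(μ + 3) / 4 + (m : ℂ)) = -(μ + 3) / 2 + 2 * m - 1 + 1 by ring,
      ← gaussPow_mul_cpow _ _ _ hz, Complex.cpow_one]
    field_simp
  · rw [Complex.ofReal_neg, mul_neg, psi2_neg, neg_one_mul]
  · rw [Complex.ofReal_neg, neg_sq, mul_neg, mul_neg, neg_one_mul]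
  · have h0 : (z : ℂ) ≠ 0 := by exact_mod_cast hz.ne'
    rw [mul_assoc _ (Complex.exp _), exp_mul_cpow_eq_gaussPow hr0 _ hz,
      show -(μ + 3) / 2 = 2 * (-(μ + 5) / 4) + 1 by ring, ← gaussPow_mul_cpow _ _ _ hz,
      Complex.cpow_one]
    ring
  · rw [Complex.ofReal_neg, mul_neg, psi2_neg, neg_sq, neg_one_mul, mul_neg]
  · rw [Complex.ofReal_neg, neg_sq, neg_neg, one_mul]
  · rw [mul_assoc _ (Complex.exp _), exp_mul_cpow_eq_gaussPow hr0 _ hz,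
      show (m : ℂ) - (μ + 5) / 4 = -(μ + 5) / 4 + m by ring, Complex.cpow_add _ _ hr0,
      Complex.cpow_natCast,
      show 2 * (-(μ + 5) / 4 + (m : ℂ)) = -(μ + 3) / 2 + 2 * m - 1 by ring]
    field_simp
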